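/- The following three injective binary morphisms are strongly interference-free: the Mephisto-Waltz morphism a ↦ aab, b ↦ bba; the Thue-Morse-Morse morphism a ↦ abb, b ↦ baa; and the last-nonzero-digit morphism a ↦ aba, b ↦ abb. -/

import Mathlib

/-- Extension of a letter map `φ` to a morphism on words. -/
def wlift {α β : Type*} (φ : α → List β) (u : List α) : List β := (u.map φ).flatten

/-- Set of starting positions (0-indexed) of occurrences of `u` in `w`. -/
def Occ {β : Type*} (u w : List β) : Set ℕ := {i | i ≤ w.length ∧ u <+: w.drop i}

/-- Number of occurrences of `u` as a factor of `w`. -/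
noncomputable def occ {β : Type*} (u w : List β) : ℕ := (Occ u w).ncard

/-- `w` admits a `φ`-image factorization. -/
def ImageFact {α β : Type*} (φ : α → List β) (w : List β) : Prop :=
  ∃ s : List α, w = wlift φ s

/-- `w` admits an interfered `φ`-image factorization. -/
def InterferedFact {α β : Type*} (φ : α → List β) (w : List β) : Prop :=
  ∃ x y z : List β, w = x ++ y ++ z ∧
    (∃ c : α, x <:+ φ c ∧ x ≠ φ c) ∧
    ImageFact φ y ∧
    (∃ c' : α, z <+: φ c' ∧ z ≠ φ c') ∧
    x ++ z ≠ []

/-- `w` is an inner `φ`-image factor. -/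
def InnerImageFactor {α β : Type*} (φ : α → List β) (w : List β) : Prop :=
  ∃ c : α, w <:+: φ c ∧ ¬ w <+: φ c ∧ ¬ w <:+ φ c

/-- `φ` is interference-free on the set `L` of words. -/
def InterferenceFree {α β : Type*} (φ : α → List β) (L : Set (List α)) : Prop :=
  ∀ u ∈ L, u ≠ [] →
    ¬ InterferedFact φ (wlift φ u) ∧ ¬ InnerImageFactor φ (wlift φ u)

/-- The binary alphabet. -/
inductive Ltr : Type
  | a : Ltr
  | b : Ltr

/-- The Mephisto-Waltz morphism: a ↦ aab, b ↦ bba. -/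
def mw : Ltr → List Ltr
  | Ltr.a => [Ltr.a, Ltr.a, Ltr.b]
  | Ltr.b => [Ltr.b, Ltr.b, Ltr.a]

/-- The Thue-Morse-Morse morphism: a ↦ abb, b ↦ baa. -/
def tmm : Ltr → List Ltr
  | Ltr.a => [Ltr.a, Ltr.b, Ltr.b]
  | Ltr.b => [Ltr.b, Ltr.a, Ltr.a]

/-- The last-nonzero-digit morphism: a ↦ aba, b ↦ abb. -/
def lnz : Ltr → List Ltr
  | Ltr.a => [Ltr.a, Ltr.b, Ltr.a]
  | Ltr.b => [Ltr.a, Ltr.b, Ltr.b]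

section UniformMorphism

variable {α β : Type*} {φ : α → List β} {n : ℕ}

theorem wlift_cons (φ : α → List β) (c : α) (u : List α) :
    wlift φ (c :: u) = φ c ++ wlift φ u := by
  simp [wlift]

theorem length_wlift_of_uniform (hlen : ∀ c, (φ c).length = n) (u : List α) :
    (wlift φ u).length = n * u.length := by
  induction u with
  | nil => simp [wlift]
  | cons c u ih => rw [wlift_cons, List.length_append, hlen, ih, List.length_cons]; ring

theorem wlift_injective_of_uniform (hn : 0 < n) (hlen : ∀ c, (φ c).length = n)
    (hinj : Function.Injective φ) : Function.Injective (wlift φ) := by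
  intro u v h
  induction u generalizing v with
  | nil =>
    have hl := congrArg List.length h
    rw [length_wlift_of_uniform hlen, length_wlift_of_uniform hlen] at hl
    simpa [hn.ne', eq_comm] using hl
  | cons c u ih =>
    cases v with
    | nil =>
      have hl := congrArg List.length h
      rw [length_wlift_of_uniform hlen, length_wlift_of_uniform hlen] at hl
      simp [hn.ne'] at hl
    | cons d v =>
      rw [wlift_cons, wlift_cons] at h
      obtain ⟨h1, h2⟩ := List.append_inj h (by rw [hlen, hlen])
      rw [hinj h1, ih h2]

/-- The image of a non-empty word under a uniform morphism is too long to be an inner factor. -/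
theorem not_innerImageFactor_of_uniform (hlen : ∀ c, (φ c).length = n) {u : List α}
    (hu : u ≠ []) : ¬ InnerImageFactor φ (wlift φ u) := by
  rintro ⟨c, hin, hpre, -⟩
  apply hpre
  have hle : (φ c).length ≤ (wlift φ u).length := by
    rw [hlen, length_wlift_of_uniform hlen]
    exact Nat.le_mul_of_pos_right n (List.length_pos_iff.mpr hu)
  rw [hin.eq_of_length_le hle]

/-- A uniform morphism has no interfered factorization if no image is composed of a proper
non-empty suffix of an image followed by a proper non-empty prefix of an image. -/
theorem not_interferedFact_of_uniform (hlen : ∀ c, (φ c).length = n)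
    (hφ : ∀ c d e k, 0 < k → k < n → (φ c).drop k ++ (φ d).take k ≠ φ e) {u : List α}
    (hu : u ≠ []) : ¬ InterferedFact φ (wlift φ u) := by
  rintro ⟨x, y, z, hw, ⟨c, hx, hxc⟩, ⟨s, rfl⟩, ⟨d, hz, hzd⟩, hxz⟩
  have hxn : x.length < n := by
    have := hx.length_le
    have := mt hx.eq_of_length hxc
    have := hlen c
    omega
  have hzn : z.length < n := by
    have := hz.length_le
    have := mt hz.eq_of_length hzd
    have := hlen d
    omega
  have hsum : x.length + z.length = n := by
    have hl := congrArg List.length hw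
    simp only [List.length_append, length_wlift_of_uniform hlen] at hl
    have hdvd : n ∣ x.length + z.length := by
      rw [← Nat.dvd_add_left (Dvd.intro s.length rfl)]
      exact ⟨u.length, by omega⟩
    have hpos : 0 < x.length + z.length := by
      rw [← List.length_append]
      exact List.length_pos_iff.mpr hxz
    obtain ⟨m, hm⟩ := hdvd
    have hm2 : m < 2 := by
      by_contra! h
      have := Nat.mul_le_mul_left n h
      omega
    interval_cases m <;> omega
  obtain ⟨d', r, hr⟩ : ∃ d' r, wlift φ s ++ z = (φ d').take z.length ++ r := by
    cases s with
    | nil => exact ⟨d, [], by simpa [wlift] using List.prefix_iff_eq_take.mp hz⟩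
    | cons d' s =>
      refine ⟨d', (φ d').drop z.length ++ (wlift φ s ++ z), ?_⟩
      rw [wlift_cons, ← List.append_assoc, List.take_append_drop, List.append_assoc]
  obtain ⟨e, v, rfl⟩ := List.exists_cons_of_ne_nil hu
  have hxd : x = (φ c).drop z.length := by
    have h := List.suffix_iff_eq_drop.mp hx
    rwa [hlen, ← hsum, Nat.add_sub_cancel_left] at h
  refine hφ c d' e z.length (by omega) hzn ?_
  rw [wlift_cons, List.append_assoc, hr, ← List.append_assoc] at hw
  rw [← hxd]
  refine (List.append_inj hw ?_).1.symm
  rw [List.length_append, List.length_take, hlen, hlen]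
  omega

theorem strongly_interferenceFree_of_uniform (hn : 0 < n) (hlen : ∀ c, (φ c).length = n)
    (hinj : Function.Injective φ)
    (hφ : ∀ c d e k, 0 < k → k < n → (φ c).drop k ++ (φ d).take k ≠ φ e) :
    Function.Injective (wlift φ) ∧ InterferenceFree φ Set.univ :=
  ⟨wlift_injective_of_uniform hn hlen hinj, fun _ _ hu =>
    ⟨not_interferedFact_of_uniform hlen hφ hu, not_innerImageFactor_of_uniform hlen hu⟩⟩

end UniformMorphism

theorem three_sif_morphisms :
    (Function.Injective (wlift mw) ∧ InterferenceFree mw Set.univ) ∧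
    (Function.Injective (wlift tmm) ∧ InterferenceFree tmm Set.univ) ∧
    (Function.Injective (wlift lnz) ∧ InterferenceFree lnz Set.univ) := by
  refine ⟨strongly_interferenceFree_of_uniform (n := 3) three_pos ?len ?inj ?comp,
    strongly_interferenceFree_of_uniform (n := 3) three_pos ?len' ?inj' ?comp',
    strongly_interferenceFree_of_uniform (n := 3) three_pos ?len'' ?inj'' ?comp''⟩
  case len | len' | len'' => rintro (_ | _) <;> rfl
  case inj | inj' | inj'' => rintro (_ | _) (_ | _) h <;> simp_all [mw, tmm, lnz]
  case comp | comp' | comp'' =>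
    rintro (_ | _) (_ | _) (_ | _) k hk hk3 <;> interval_cases k <;> simp [mw, tmm, lnz]
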